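/- Let T be a bounded linear operator on a nontrivial complex Hilbert space H. Then w²(T|T|) ≤ (1/4) ‖ T*T + TT* ‖² − (1/4) · inf_{‖x‖=1} ⟨(T*T − TT*)x, x⟩². -/

import Mathlib

open scoped InnerProductSpace NNReal

variable {H : Type*} [NormedAddCommGroup H] [InnerProductSpace ℂ H] [CompleteSpace H]

/-- The numerical radius `w(T) = sup { |⟨Tx, x⟩| : ‖x‖ = 1 }`. -/
noncomputable def numRadius (T : H →L[ℂ] H) : ℝ :=
  ⨆ x : {x : H // ‖x‖ = 1}, ‖⟪T x.1, x.1⟫_ℂ‖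

/-- The absolute value `|T| = (T*T)^(1/2)`. -/
noncomputable def opAbs (T : H →L[ℂ] H) : H →L[ℂ] H :=
  CFC.sqrt (star T * T)

/-- The real power `|T|^s` of the absolute value, via the continuous functional calculus. -/
noncomputable def opAbsPow (T : H →L[ℂ] H) (s : ℝ) : H →L[ℂ] H :=
  CFC.rpow (opAbs T) s

lemma opAbs_mul_self (T : H →L[ℂ] H) : opAbs T * opAbs T = star T * T :=
  CFC.sqrt_mul_sqrt_self (star T * T) (star_mul_self_nonneg T)

lemma star_opAbs (T : H →L[ℂ] H) : star (opAbs T) = opAbs T :=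
  (IsSelfAdjoint.of_nonneg (CFC.sqrt_nonneg (star T * T))).star_eq

lemma inner_star_mul_self_apply (T : H →L[ℂ] H) (x : H) :
    ⟪(star T * T) x, x⟫_ℂ = ((‖T x‖ ^ 2 : ℝ) : ℂ) := by
  rw [mul_apply_eq_comp, ContinuousLinearMap.star_eq_adjoint,
    ContinuousLinearMap.adjoint_inner_left, inner_self_eq_norm_sq_to_K]
  simp

lemma inner_mul_star_self_apply (T : H →L[ℂ] H) (x : H) :
    ⟪(T * star T) x, x⟫_ℂ = ((‖star T x‖ ^ 2 : ℝ) : ℂ) := by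
  simpa using inner_star_mul_self_apply (star T) x

lemma norm_opAbs_apply_sq (T : H →L[ℂ] H) (x : H) : ‖opAbs T x‖ ^ 2 = ‖T x‖ ^ 2 := by
  have h := inner_star_mul_self_apply (opAbs T) x
  rw [star_opAbs, opAbs_mul_self, inner_star_mul_self_apply] at h
  exact_mod_cast h.symm

lemma norm_inner_mul_opAbs_sq_le (T : H →L[ℂ] H) (x : H) :
    ‖⟪(T * opAbs T) x, x⟫_ℂ‖ ^ 2 ≤ ‖T x‖ ^ 2 * ‖star T x‖ ^ 2 := by
  rw [← norm_opAbs_apply_sq, ← mul_pow, mul_apply_eq_comp,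
    ← ContinuousLinearMap.adjoint_inner_right, ← ContinuousLinearMap.star_eq_adjoint]
  gcongr
  exact norm_inner_le_norm _ _

lemma norm_sq_add_norm_star_sq_le (T : H →L[ℂ] H) {x : H} (hx : ‖x‖ = 1) :
    ‖T x‖ ^ 2 + ‖star T x‖ ^ 2 ≤ ‖star T * T + T * star T‖ := by
  have h : ⟪(star T * T + T * star T) x, x⟫_ℂ =
      ((‖T x‖ ^ 2 + ‖star T x‖ ^ 2 : ℝ) : ℂ) := by
    rw [add_apply, inner_add_left, inner_star_mul_self_apply,
      inner_mul_star_self_apply, Complex.ofReal_add]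
  calc ‖T x‖ ^ 2 + ‖star T x‖ ^ 2 = ‖⟪(star T * T + T * star T) x, x⟫_ℂ‖ := by
        rw [h, Complex.norm_real, Real.norm_of_nonneg (by positivity)]
    _ ≤ ‖(star T * T + T * star T) x‖ * ‖x‖ := norm_inner_le_norm _ _
    _ ≤ ‖star T * T + T * star T‖ := by
        simpa [hx] using (star T * T + T * star T).le_opNorm x

theorem stmt4 [Nontrivial H] (T : H →L[ℂ] H) :
    numRadius (T * opAbs T) ^ 2 ≤
      (1 / 4 : ℝ) * ‖star T * T + T * star T‖ ^ 2 -
        (1 / 4 : ℝ) *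
          ⨅ x : {x : H // ‖x‖ = 1},
            ((⟪(star T * T - T * star T) x.1, x.1⟫_ℂ).re) ^ 2 := by
  set C : ℝ := (1 / 4 : ℝ) * ‖star T * T + T * star T‖ ^ 2 -
        (1 / 4 : ℝ) *
          ⨅ x : {x : H // ‖x‖ = 1},
            ((⟪(star T * T - T * star T) x.1, x.1⟫_ℂ).re) ^ 2 with hC
  have key (x : {x : H // ‖x‖ = 1}) : ‖⟪(T * opAbs T) x.1, x.1⟫_ℂ‖ ^ 2 ≤ C := by
    have hinf : (⨅ x : {x : H // ‖x‖ = 1},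
        ((⟪(star T * T - T * star T) x.1, x.1⟫_ℂ).re) ^ 2) ≤
          (‖T x.1‖ ^ 2 - ‖star T x.1‖ ^ 2) ^ 2 := by
      refine (ciInf_le ⟨0, ?_⟩ x).trans_eq ?_
      · rintro _ ⟨y, rfl⟩
        positivity
      · rw [sub_apply, inner_sub_left, inner_star_mul_self_apply,
          inner_mul_star_self_apply, ← Complex.ofReal_sub, Complex.ofReal_re]
    have hsum := pow_le_pow_left₀ (by positivity) (norm_sq_add_norm_star_sq_le T x.2) 2
    have hprod := norm_inner_mul_opAbs_sq_le T x.1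
    rw [hC]
    linarith
  obtain ⟨x, hx⟩ := exists_norm_eq H zero_le_one
  have : Nonempty {x : H // ‖x‖ = 1} := ⟨⟨x, hx⟩⟩
  have hC0 : 0 ≤ C := (sq_nonneg _).trans (key ⟨x, hx⟩)
  have hle : numRadius (T * opAbs T) ≤ √C := ciSup_le fun y => Real.le_sqrt_of_sq_le (key y)
  have h0 : 0 ≤ numRadius (T * opAbs T) := Real.iSup_nonneg fun _ => norm_nonneg _
  exact (Real.le_sqrt h0 hC0).mp hle
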